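/- arXiv:2508.19704 — 3 statements merged into one kernel-verified Lean document; each statement's English description precedes it below -/
import Mathlib

section
/- For every partition λ, the following identities hold in the field ℚ(q1,q2): 1 − (1−q1)(1−q2)·Σ_{c∈λ} χ_c = Σ_{c∈A(λ)} χ_c − q1·q2·Σ_{c∈R(λ)} χ_c, and moreover this common value equals ((1−q1)/q1)·( Σ_{i=1}^{ℓ} q1^i q2^{λ_i} + q1^{ℓ+1}/(1−q1) ) for every integer ℓ greater than or equal to the number of nonzero parts of λ (i.e. it equals the regularized sum ε_λ = Σ_{i≥1} q1^i q2^{λ_i} divided by ε_∅ = q1/(1−q1)). -/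
open scoped BigOperators

noncomputable section

/-- The field `ℚ(q1, q2)` of rational functions in two independent indeterminates. -/
abbrev K : Type := FractionRing (MvPolynomial (Fin 2) ℚ)

/-- The indeterminate `q1`. -/
def q1 : K := algebraMap (MvPolynomial (Fin 2) ℚ) K (MvPolynomial.X 0)

/-- The indeterminate `q2`. -/
def q2 : K := algebraMap (MvPolynomial (Fin 2) ℚ) K (MvPolynomial.X 1)

/-- Box content `χ_c = q1^(i-1) * q2^(j-1)` of the 1-indexed cell `(i,j)`.
Here cells of a `YoungDiagram` are 0-indexed, so the cell `c` corresponding to the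
1-indexed cell `(i,j)` is `c = (i-1, j-1)` and `χ_c = q1^c.1 * q2^c.2`. -/
def chi (c : ℕ × ℕ) : K := q1 ^ c.1 * q2 ^ c.2

/-- `c` is an addable cell of the Young diagram `d`: it is not a cell of `d` and adjoining
it again gives (the cells of) a Young diagram. -/
def IsAddable (d : YoungDiagram) (c : ℕ × ℕ) : Prop :=
  c ∉ d.cells ∧ IsLowerSet (↑(insert c d.cells) : Set (ℕ × ℕ))

/-- `c` is a removable cell of the Young diagram `d`: it is a cell of `d` and deleting
it again gives (the cells of) a Young diagram. -/
def IsRemovable (d : YoungDiagram) (c : ℕ × ℕ) : Prop :=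
  c ∈ d.cells ∧ IsLowerSet (↑(d.cells.erase c) : Set (ℕ × ℕ))

open Classical in
/-- The (finite) set `A(d)` of addable cells of `d`; every addable cell `(i,j)` satisfies
`i ≤ colLen 0` and `j ≤ rowLen 0`, so filtering the bounding box captures all of them. -/
noncomputable def addables (d : YoungDiagram) : Finset (ℕ × ℕ) :=
  (Finset.range (d.colLen 0 + 1) ×ˢ Finset.range (d.rowLen 0 + 1)).filter (IsAddable d)

open Classical in
/-- The (finite) set `R(d)` of removable cells of `d`. -/
noncomputable def removables (d : YoungDiagram) : Finset (ℕ × ℕ) :=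
  d.cells.filter (IsRemovable d)

theorem aux_add (d : YoungDiagram) (i j : ℕ) :
    IsAddable d (i, j) ↔ j = d.rowLen i ∧ (i = 0 ∨ d.rowLen i < d.rowLen (i - 1)) := by
  constructor
  · rintro ⟨h1, h2⟩
    rw [YoungDiagram.mem_cells, YoungDiagram.mem_iff_lt_rowLen] at h1
    have key : ∀ a b, a ≤ i → b ≤ j → (a, b) ≠ (i, j) → b < d.rowLen a := by
      intro a b ha hb hne
      have := h2 (show ((a, b) : ℕ × ℕ) ≤ (i, j) from ⟨ha, hb⟩) (by simp)
      simp only [Finset.coe_insert, Set.mem_insert_iff, Finset.mem_coe] at this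
      rcases this with h | h
      · exact absurd h hne
      · rwa [YoungDiagram.mem_cells, YoungDiagram.mem_iff_lt_rowLen] at h
    have hj : j = d.rowLen i := by
      rcases Nat.eq_zero_or_pos j with h0 | h0
      · omega
      · have := key i (j - 1) le_rfl (by omega) (by simp; omega)
        omega
    refine ⟨hj, ?_⟩
    rcases Nat.eq_zero_or_pos i with h0 | h0
    · exact Or.inl h0
    · right
      have := key (i - 1) j (by omega) le_rfl (by simp; omega)
      omega
  · rintro ⟨hj, hi⟩
    refine ⟨by rw [YoungDiagram.mem_cells, YoungDiagram.mem_iff_lt_rowLen]; omega, ?_⟩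
    rintro ⟨a, b⟩ ⟨a', b'⟩ ⟨h1, h2⟩ hm
    simp only [Finset.coe_insert, Set.mem_insert_iff, Finset.mem_coe, Prod.mk.injEq,
      YoungDiagram.mem_cells, YoungDiagram.mem_iff_lt_rowLen] at hm ⊢
    simp only at h1 h2
    have h3 := d.rowLen_anti _ _ h1
    rcases hm with ⟨rfl, rfl⟩ | hm
    · rcases Nat.lt_or_ge a' a with h | h
      · have := d.rowLen_anti a' (a - 1) (by omega)
        right; omega
      · have : a' = a := by omega
        subst this
        omega
    · right; omega

theorem aux_rem (d : YoungDiagram) (i j : ℕ) :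
    IsRemovable d (i, j) ↔ j + 1 = d.rowLen i ∧ d.rowLen (i + 1) < d.rowLen i := by
  constructor
  · rintro ⟨h1, h2⟩
    rw [YoungDiagram.mem_cells, YoungDiagram.mem_iff_lt_rowLen] at h1
    have key : ∀ a b, i ≤ a → j ≤ b → (a, b) ≠ (i, j) → d.rowLen a ≤ b := by
      intro a b ha hb hne
      by_contra hlt
      have := h2 (show ((i, j) : ℕ × ℕ) ≤ (a, b) from ⟨ha, hb⟩) (by
        simp only [Finset.coe_erase, Set.mem_diff, Finset.mem_coe, Set.mem_singleton_iff,
          YoungDiagram.mem_cells, YoungDiagram.mem_iff_lt_rowLen]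
        exact ⟨by omega, hne⟩)
      simp at this
    have h3 := key i (j + 1) le_rfl (by omega) (by simp)
    have h4 := key (i + 1) j (by omega) le_rfl (by simp)
    omega
  · rintro ⟨hj, hi⟩
    refine ⟨by rw [YoungDiagram.mem_cells, YoungDiagram.mem_iff_lt_rowLen]; omega, ?_⟩
    rintro ⟨a, b⟩ ⟨a', b'⟩ ⟨h1, h2⟩ hm
    simp only [Finset.coe_erase, Set.mem_diff, Finset.mem_coe, Set.mem_singleton_iff, Prod.mk.injEq,
      YoungDiagram.mem_cells, YoungDiagram.mem_iff_lt_rowLen] at hm ⊢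
    simp only at h1 h2
    have h3 := d.rowLen_anti _ _ h1
    refine ⟨by omega, ?_⟩
    rintro ⟨rfl, rfl⟩
    rcases Nat.lt_or_ge a' a with h | h
    · have := d.rowLen_anti (a' + 1) a (by omega)
      omega
    · have : a' = a := by omega
      subst this
      omega

theorem aux_row_zero (d : YoungDiagram) (i : ℕ) : d.rowLen i = 0 ↔ d.colLen 0 ≤ i := by
  have h1 := YoungDiagram.mem_iff_lt_rowLen (μ := d) (i := i) (j := 0)
  have h2 := YoungDiagram.mem_iff_lt_colLen (μ := d) (i := i) (j := 0)
  rw [h1] at h2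
  omega

theorem aux_sum_add (d : YoungDiagram) : ∑ c ∈ addables d, chi c =
    q2 ^ d.rowLen 0 + ∑ i ∈ Finset.range (d.colLen 0),
      if d.rowLen (i + 1) < d.rowLen i then q1 ^ (i + 1) * q2 ^ d.rowLen (i + 1) else 0 := by
  have : addables d = ((Finset.range (d.colLen 0 + 1)).filter
      (fun i => i = 0 ∨ d.rowLen i < d.rowLen (i - 1))).image (fun i => (i, d.rowLen i)) := by
    ext ⟨i, j⟩
    simp only [addables, Finset.mem_filter, Finset.mem_product, Finset.mem_range, aux_add,
      Finset.mem_image, Prod.mk.injEq]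
    constructor
    · rintro ⟨⟨h1, h2⟩, h3, h4⟩
      exact ⟨i, ⟨h1, h4⟩, rfl, h3.symm⟩
    · rintro ⟨a, ⟨h1, h4⟩, rfl, rfl⟩
      have := d.rowLen_anti 0 a (by omega)
      exact ⟨⟨h1, by omega⟩, rfl, h4⟩
  rw [this, Finset.sum_image (by intro a _ b _ h; exact (Prod.mk.inj h).1), Finset.sum_filter,
    Finset.sum_range_succ', add_comm]
  simp [chi]

theorem aux_sum_rem (d : YoungDiagram) : q1 * q2 * ∑ c ∈ removables d, chi c =
    ∑ i ∈ Finset.range (d.colLen 0),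
      if d.rowLen (i + 1) < d.rowLen i then q1 ^ (i + 1) * q2 ^ d.rowLen i else 0 := by
  have : removables d = ((Finset.range (d.colLen 0)).filter
      (fun i => d.rowLen (i + 1) < d.rowLen i)).image (fun i => (i, d.rowLen i - 1)) := by
    ext ⟨i, j⟩
    have h0 := aux_row_zero d i
    simp only [removables, Finset.mem_filter, Finset.mem_range, aux_rem,
      Finset.mem_image, Prod.mk.injEq, YoungDiagram.mem_cells, YoungDiagram.mem_iff_lt_rowLen]
    constructor
    · rintro ⟨h1, h3, h4⟩
      exact ⟨i, ⟨by omega, h4⟩, rfl, by omega⟩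
    · rintro ⟨a, ⟨h1, h4⟩, rfl, rfl⟩
      omega
  rw [this, Finset.sum_image (by intro a _ b _ h; exact (Prod.mk.inj h).1), Finset.sum_filter,
    Finset.mul_sum]
  refine Finset.sum_congr rfl fun i _ => ?_
  split_ifs with h
  · obtain ⟨m, hm⟩ : ∃ m, d.rowLen i = m + 1 := ⟨d.rowLen i - 1, by omega⟩
    simp only [chi, hm, Nat.add_sub_cancel]
    ring
  · simp

theorem aux_cells (d : YoungDiagram) (ℓ : ℕ) (hl : d.colLen 0 ≤ ℓ) :
    1 - (1 - q1) * (1 - q2) * ∑ c ∈ d.cells, chi c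
      = q1 ^ ℓ + (1 - q1) * ∑ i ∈ Finset.range ℓ, q1 ^ i * q2 ^ d.rowLen i := by
  have : d.cells = (Finset.range ℓ).biUnion (fun i => (Finset.range (d.rowLen i)).image
      (fun j => (i, j))) := by
    ext ⟨i, j⟩
    have h0 := aux_row_zero d i
    simp only [Finset.mem_biUnion, Finset.mem_range,
      Finset.mem_image, Prod.mk.injEq, YoungDiagram.mem_cells, YoungDiagram.mem_iff_lt_rowLen]
    constructor
    · intro h
      exact ⟨i, by omega, j, h, rfl, rfl⟩
    · rintro ⟨a, h1, b, h2, rfl, rfl⟩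
      exact h2
  have h2 : ∑ c ∈ d.cells, chi c =
      ∑ i ∈ Finset.range ℓ, ∑ j ∈ Finset.range (d.rowLen i), q1 ^ i * q2 ^ j := by
    rw [this, Finset.sum_biUnion]
    · refine Finset.sum_congr rfl fun i _ => ?_
      rw [Finset.sum_image (by intro a _ b _ h; exact (Prod.mk.inj h).2)]
      rfl
    · intro a _ b _ hab
      simp only [Function.onFun, Finset.disjoint_left, Finset.mem_image, not_exists, not_and]
      rintro x ⟨j, _, rfl⟩ k _ h
      exact hab (Prod.mk.inj h).1.symm
  have h3 : (1 - q2) * ∑ c ∈ d.cells, chi c =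
      ∑ i ∈ Finset.range ℓ, q1 ^ i - ∑ i ∈ Finset.range ℓ, q1 ^ i * q2 ^ d.rowLen i := by
    rw [h2, Finset.mul_sum, ← Finset.sum_sub_distrib]
    refine Finset.sum_congr rfl fun i _ => ?_
    rw [← Finset.mul_sum]
    linear_combination q1 ^ i * mul_neg_geom_sum q2 (d.rowLen i)
  linear_combination (-(1 - q1)) * h3 - mul_neg_geom_sum q1 ℓ

theorem aux_q1_ne : q1 ≠ 0 := by
  unfold q1
  rw [Ne, FaithfulSMul.algebraMap_eq_zero_iff]
  exact MvPolynomial.X_ne_zero 0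

theorem aux_q1_ne_one : 1 - q1 ≠ 0 := by
  unfold q1
  rw [sub_ne_zero, ← map_one (algebraMap (MvPolynomial (Fin 2) ℚ) K)]
  intro h
  have h := IsFractionRing.injective (MvPolynomial (Fin 2) ℚ) K h
  have := congrArg (MvPolynomial.eval (fun _ => (0 : ℚ))) h
  simp at this

/-- For every partition `λ`:
`1 − (1−q1)(1−q2)·Σ_{c∈λ} χ_c = Σ_{c∈A(λ)} χ_c − q1 q2·Σ_{c∈R(λ)} χ_c`, and this common
value equals `((1−q1)/q1)·(Σ_{i=1}^{ℓ} q1^i q2^{λ_i} + q1^{ℓ+1}/(1−q1))` for every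
`ℓ ≥` the number of nonzero parts of `λ`. -/
theorem stmt0 (d : YoungDiagram) :
    (1 - (1 - q1) * (1 - q2) * ∑ c ∈ d.cells, chi c
        = (∑ c ∈ addables d, chi c) - q1 * q2 * ∑ c ∈ removables d, chi c) ∧
      ∀ ℓ : ℕ, d.colLen 0 ≤ ℓ →
        1 - (1 - q1) * (1 - q2) * ∑ c ∈ d.cells, chi c
          = ((1 - q1) / q1) *
              ((∑ i ∈ Finset.range ℓ, q1 ^ (i + 1) * q2 ^ d.rowLen i)
                + q1 ^ (ℓ + 1) / (1 - q1)) := by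
  refine ⟨?_, fun ℓ hl => ?_⟩
  · rw [aux_cells d _ le_rfl, aux_sum_rem, aux_sum_add, add_sub_assoc, ← Finset.sum_sub_distrib]
    have h1 : ∀ i ∈ Finset.range (d.colLen 0),
        ((if d.rowLen (i + 1) < d.rowLen i then q1 ^ (i + 1) * q2 ^ d.rowLen (i + 1) else 0) -
        (if d.rowLen (i + 1) < d.rowLen i then q1 ^ (i + 1) * q2 ^ d.rowLen i else 0))
        = q1 ^ (i + 1) * q2 ^ d.rowLen (i + 1) - q1 * (q1 ^ i * q2 ^ d.rowLen i) := by
      intro i _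
      have := d.rowLen_anti i (i + 1) (by omega)
      split_ifs with h
      · ring
      · rw [show d.rowLen (i + 1) = d.rowLen i by omega]
        ring
    rw [Finset.sum_congr rfl h1, Finset.sum_sub_distrib, ← Finset.mul_sum]
    have h2 := Finset.sum_range_succ (fun i => q1 ^ i * q2 ^ d.rowLen i) (d.colLen 0)
    rw [Finset.sum_range_succ', (aux_row_zero d (d.colLen 0)).2 le_rfl] at h2
    linear_combination -h2
  · rw [aux_cells d ℓ hl]
    have h1 : ∑ i ∈ Finset.range ℓ, q1 ^ (i + 1) * q2 ^ d.rowLen i =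
        q1 * ∑ i ∈ Finset.range ℓ, q1 ^ i * q2 ^ d.rowLen i := by
      rw [Finset.mul_sum]
      exact Finset.sum_congr rfl fun i _ => by ring
    rw [h1]
    have := aux_q1_ne
    have := aux_q1_ne_one
    field_simp
    ring

end
end

section
/- Let λ and μ be partitions such that λ is not contained in μ (i.e. λ_i > μ_i for some i). Then the specialization of the Nekrasov factor at z = q3 = (q1 q2)^{−1} vanishes identically: N_{λ,μ}(q3) = 0 as an element of the Laurent polynomial ring ℤ[q1^{±1}, q2^{±1}] (one of the factors of the defining product is literally zero). -/
open scoped BigOperators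

noncomputable section

/-- `q3 = (q1 q2)⁻¹`. -/
def q3 : K := (q1 * q2)⁻¹

/-- The (K-theoretic) Nekrasov factor
`N_{λ,μ}(w) = ∏_{(i,j)∈λ} (1 − w q1^{λ^T_j − i + 1} q2^{j − μ_i})`
`           · ∏_{(i,j)∈μ} (1 − w q1^{i − μ^T_j} q2^{λ_i − j + 1})`
written in terms of 0-indexed cells (`λ^T_j = colLen (j-1)`, `λ_i = rowLen (i-1)`). -/
def nek (lam mu : YoungDiagram) (w : K) : K :=
  (∏ c ∈ lam.cells,
      (1 - w * q1 ^ ((lam.colLen c.2 : ℤ) - (c.1 : ℤ)) *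
        q2 ^ ((c.2 : ℤ) + 1 - (mu.rowLen c.1 : ℤ)))) *
    ∏ c ∈ mu.cells,
      (1 - w * q1 ^ ((c.1 : ℤ) + 1 - (mu.colLen c.2 : ℤ)) *
        q2 ^ ((lam.rowLen c.1 : ℤ) - (c.2 : ℤ)))

/-- If `λ` is not contained in `μ` (i.e. `μ_i < λ_i` for some `i`), then the Nekrasov
factor vanishes at `z = q3 = (q1 q2)⁻¹`: `N_{λ,μ}(q3) = 0`. -/
theorem stmt8 (lam mu : YoungDiagram) (h : ∃ i : ℕ, mu.rowLen i < lam.rowLen i) :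
    nek lam mu q3 = 0 := by
  classical
  obtain ⟨i₀, h₀⟩ := h
  have hb : ∀ i, mu.rowLen i < lam.rowLen i → i ≤ lam.colLen 0 := by
    intro i hi
    have h1 : (i, 0) ∈ lam := YoungDiagram.mem_iff_lt_rowLen.2 (by omega)
    exact (YoungDiagram.mem_iff_lt_colLen.1 h1).le
  obtain ⟨i, hi, hmax⟩ : ∃ i, mu.rowLen i < lam.rowLen i ∧
      ¬ mu.rowLen (i + 1) < lam.rowLen (i + 1) := by
    refine ⟨Nat.findGreatest (fun i => mu.rowLen i < lam.rowLen i) (lam.colLen 0),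
      Nat.findGreatest_spec (P := fun i => mu.rowLen i < lam.rowLen i) (hb i₀ h₀) h₀, ?_⟩
    intro hlt
    have := Nat.le_findGreatest (P := fun i => mu.rowLen i < lam.rowLen i) (hb _ hlt) hlt
    omega
  have hmem : (i, mu.rowLen i) ∈ lam := YoungDiagram.mem_iff_lt_rowLen.2 hi
  have hcol : lam.colLen (mu.rowLen i) = i + 1 := by
    have h1 := YoungDiagram.mem_iff_lt_colLen.1 hmem
    have h2 : ¬ (i + 1 < lam.colLen (mu.rowLen i)) := by
      intro h3
      have h4 := YoungDiagram.mem_iff_lt_rowLen.1 (YoungDiagram.mem_iff_lt_colLen.2 h3)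
      have h5 := mu.rowLen_anti i (i + 1) (by omega)
      omega
    omega
  have hq1 : q1 ≠ 0 := by
    unfold q1
    simp
  have hq2 : q2 ≠ 0 := by
    unfold q2
    simp
  unfold nek
  apply mul_eq_zero_of_left
  apply Finset.prod_eq_zero ((YoungDiagram.mem_cells _).2 hmem)
  have e1 : ((lam.colLen (mu.rowLen i) : ℤ) - (i : ℤ)) = 1 := by
    rw [hcol]; push_cast; ring
  have e2 : ((mu.rowLen i : ℤ) + 1 - (mu.rowLen i : ℤ)) = 1 := by ring
  simp only [e1, e2, zpow_one, q3]
  rw [mul_assoc, inv_mul_cancel₀ (mul_ne_zero hq1 hq2), sub_self]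

end
end

section
/- For every partition λ and every addable cell (i,j) ∈ A(λ), the following identity holds in ℚ(q,t): b_{λ∪{(i,j)}} · (1 − q) · ψ*_{λ∪{(i,j)}}(i,j) = b_λ · (1 − t) · ψ_λ(i,j). (Variation formula for the Macdonald norm coefficient: b_{λ+□}/b_λ = ((1−t)/(1−q)) ψ_λ(□)/ψ*_{λ+□}(□).) -/
open scoped BigOperators

noncomputable section

/-- The indeterminate `q`. -/
def q : K := algebraMap (MvPolynomial (Fin 2) ℚ) K (MvPolynomial.X 0)

/-- The indeterminate `t`. -/
def t : K := algebraMap (MvPolynomial (Fin 2) ℚ) K (MvPolynomial.X 1)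

/-- The Young diagram `λ ∪ {c}` obtained by adjoining an addable cell `c` to `λ`. -/
def addCell (d : YoungDiagram) (c : ℕ × ℕ)
    (h : IsLowerSet (↑(insert c d.cells) : Set (ℕ × ℕ))) : YoungDiagram :=
  ⟨insert c d.cells, h⟩

/-- The Macdonald norm coefficient
`b_λ = ∏_{(i,j)∈λ} (1 − q^{λ_i−j} t^{λ^T_j−i+1})/(1 − q^{λ_i−j+1} t^{λ^T_j−i})`
(written in 0-indexed cells: for `c = (i-1, j-1)`, `λ_i − j = rowLen c.1 − c.2 − 1`,
`λ^T_j − i + 1 = colLen c.2 − c.1`). -/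
def bcoef (d : YoungDiagram) : K :=
  ∏ c ∈ d.cells,
    (1 - q ^ ((d.rowLen c.1 : ℤ) - (c.2 : ℤ) - 1) * t ^ ((d.colLen c.2 : ℤ) - (c.1 : ℤ))) /
      (1 - q ^ ((d.rowLen c.1 : ℤ) - (c.2 : ℤ)) * t ^ ((d.colLen c.2 : ℤ) - (c.1 : ℤ) - 1))

/-- The Pieri coefficient `ψ_λ(i,j)` (for the 1-indexed cell `(i,j) = (c.1+1, c.2+1)`):
`ψ_λ(i,j) = ∏_{i'=1}^{i−1} [(1 − q^{λ_{i'}−j+1} t^{i−i'−1})(1 − q^{λ_{i'}−j} t^{i−i'+1})]`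
`            / [(1 − q^{λ_{i'}−j+1} t^{i−i'})(1 − q^{λ_{i'}−j} t^{i−i'})]`. -/
def psi (d : YoungDiagram) (c : ℕ × ℕ) : K :=
  ∏ k ∈ Finset.range c.1,
    ((1 - q ^ ((d.rowLen k : ℤ) - (c.2 : ℤ)) * t ^ ((c.1 : ℤ) - (k : ℤ) - 1)) *
        (1 - q ^ ((d.rowLen k : ℤ) - (c.2 : ℤ) - 1) * t ^ ((c.1 : ℤ) - (k : ℤ) + 1))) /
      ((1 - q ^ ((d.rowLen k : ℤ) - (c.2 : ℤ)) * t ^ ((c.1 : ℤ) - (k : ℤ))) *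
        (1 - q ^ ((d.rowLen k : ℤ) - (c.2 : ℤ) - 1) * t ^ ((c.1 : ℤ) - (k : ℤ))))

/-- The dual Pieri coefficient `ψ*_λ(i,j)` (for the 1-indexed cell `(i,j) = (c.1+1, c.2+1)`):
`ψ*_λ(i,j) = ∏_{j'=1}^{j−1} [(1 − q^{j−j'−1} t^{λ^T_{j'}−i+1})(1 − q^{j−j'+1} t^{λ^T_{j'}−i})]`
`             / [(1 − q^{j−j'} t^{λ^T_{j'}−i+1})(1 − q^{j−j'} t^{λ^T_{j'}−i})]`. -/
def psiStar (d : YoungDiagram) (c : ℕ × ℕ) : K :=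
  ∏ k ∈ Finset.range c.2,
    ((1 - q ^ ((c.2 : ℤ) - (k : ℤ) - 1) * t ^ ((d.colLen k : ℤ) - (c.1 : ℤ))) *
        (1 - q ^ ((c.2 : ℤ) - (k : ℤ) + 1) * t ^ ((d.colLen k : ℤ) - (c.1 : ℤ) - 1))) /
      ((1 - q ^ ((c.2 : ℤ) - (k : ℤ)) * t ^ ((d.colLen k : ℤ) - (c.1 : ℤ))) *
        (1 - q ^ ((c.2 : ℤ) - (k : ℤ)) * t ^ ((d.colLen k : ℤ) - (c.1 : ℤ) - 1)))

theorem nz_aux (m n : ℤ) (hm : 0 ≤ m) (hn : 0 ≤ n) (h : 0 < m + n) :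
    (1 : K) - q ^ m * t ^ n ≠ 0 := by
  lift m to ℕ using hm
  lift n to ℕ using hn
  intro h0
  have h1 : algebraMap (MvPolynomial (Fin 2) ℚ) K
      (MvPolynomial.X 0 ^ m * MvPolynomial.X 1 ^ n) = algebraMap _ K 1 := by
    simp only [map_mul, map_pow, map_one]
    simp only [zpow_natCast] at h0
    exact (sub_eq_zero.mp h0).symm
  have h2 := IsFractionRing.injective (MvPolynomial (Fin 2) ℚ) K h1
  have h3 := congrArg (MvPolynomial.eval (fun _ => (2 : ℚ))) h2
  simp only [map_mul, map_pow, map_one, MvPolynomial.eval_X, ← pow_add] at h3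
  have : (1 : ℚ) < 2 ^ (m + n) := one_lt_pow₀ (by norm_num) (by omega)
  linarith

theorem alg_row (A B C D : K) (hA : A ≠ 0) (hB : B ≠ 0) :
    A / B * (C * B / (A * D)) = C / D * 1 := by
  field_simp

theorem alg_col (A B C D : K) (hA : A ≠ 0) (hB : B ≠ 0) :
    C / D * 1 = B / A * (A * C / (D * B)) := by
  field_simp

theorem stmt9_rowLen (d : YoungDiagram) (c : ℕ × ℕ) (h : IsAddable d c) (i : ℕ) :
    d.rowLen c.1 = c.2 ∧ d.colLen c.2 = c.1 ∧
    (addCell d c h.2).rowLen i = d.rowLen i + (if i = c.1 then 1 else 0) ∧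
    (addCell d c h.2).colLen i = d.colLen i + (if i = c.2 then 1 else 0) := by
  obtain ⟨a, b⟩ := c
  have hm : ∀ x y, (x, y) ∈ addCell d (a, b) h.2 ↔ ((x = a ∧ y = b) ∨ (x, y) ∈ d) := by
    intro x y
    rw [← YoungDiagram.mem_cells]
    simp [addCell]
  have hn : (a, b) ∉ d := fun hh => h.1 hh
  have low : ∀ x y, x ≤ a → y ≤ b → ¬ (x = a ∧ y = b) → (x, y) ∈ d := by
    intro x y hx hy hne
    have := (addCell d (a, b) h.2).up_left_mem hx hy ((hm a b).2 (Or.inl ⟨rfl, rfl⟩))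
    exact ((hm x y).1 this).resolve_left hne
  have hr : d.rowLen a = b := by
    apply le_antisymm
    · rw [YoungDiagram.mem_iff_lt_rowLen] at hn; omega
    · by_contra hlt
      push Not at hlt
      have := low a (d.rowLen a) le_rfl hlt.le (by omega)
      rw [YoungDiagram.mem_iff_lt_rowLen] at this; omega
  have hc : d.colLen b = a := by
    apply le_antisymm
    · rw [YoungDiagram.mem_iff_lt_colLen] at hn; omega
    · by_contra hlt
      push Not at hlt
      have := low (d.colLen b) b hlt.le le_rfl (by omega)
      rw [YoungDiagram.mem_iff_lt_colLen] at this; omega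
  have nat_ext : ∀ m n : ℕ, (∀ k, k < m ↔ k < n) → m = n := by
    intro m n H
    have h1 := H m
    have h2 := H n
    omega
  refine ⟨hr, hc, ?_, ?_⟩
  · apply nat_ext
    intro k
    rw [← YoungDiagram.mem_iff_lt_rowLen, hm, YoungDiagram.mem_iff_lt_rowLen]
    dsimp only
    split_ifs with hi
    · subst hi; omega
    · omega
  · apply nat_ext
    intro k
    rw [← YoungDiagram.mem_iff_lt_colLen, hm, YoungDiagram.mem_iff_lt_colLen]
    dsimp only
    split_ifs with hi
    · subst hi; omega
    · omega

theorem prod_row_aux (d : YoungDiagram) (a m : ℕ) (hm : d.rowLen a = m) (g : ℕ → K) :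
    ∏ k ∈ Finset.range m, g k
      = ∏ x ∈ d.cells, if x.1 = a then g x.2 else 1 := by
  subst hm
  rw [← Finset.prod_filter]
  change _ = ∏ x ∈ d.row a, g x.2
  rw [YoungDiagram.row_eq_prod, Finset.prod_product]
  simp

theorem prod_col_aux (d : YoungDiagram) (b m : ℕ) (hm : d.colLen b = m) (g : ℕ → K) :
    ∏ k ∈ Finset.range m, g k
      = ∏ x ∈ d.cells, if x.2 = b then g x.1 else 1 := by
  subst hm
  rw [← Finset.prod_filter]
  change _ = ∏ x ∈ d.col b, g x.1
  rw [YoungDiagram.col_eq_prod, Finset.prod_product]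
  simp

/-- Variation formula for the Macdonald norm coefficient: for every addable cell `c` of `λ`,
`b_{λ∪{c}} (1−q) ψ*_{λ∪{c}}(c) = b_λ (1−t) ψ_λ(c)`. -/
theorem stmt9 (d : YoungDiagram) (c : ℕ × ℕ) (h : IsAddable d c) :
    bcoef (addCell d c h.2) * (1 - q) * psiStar (addCell d c h.2) c
      = bcoef d * (1 - t) * psi d c := by
  have hL := stmt9_rowLen d c h
  obtain ⟨a, b⟩ := c
  have hr : d.rowLen a = b := (hL 0).1
  have hc : d.colLen b = a := (hL 0).2.1
  have hR := fun i => (hL i).2.2.1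
  have hC := fun i => (hL i).2.2.2
  have hn : (a, b) ∉ d.cells := h.1
  dsimp only at hR hC
  have e1 : bcoef (addCell d (a, b) h.2) = (1 - t) / (1 - q) * ∏ x ∈ d.cells,
      (1 - q ^ (((addCell d (a, b) h.2).rowLen x.1 : ℤ) - (x.2 : ℤ) - 1) *
        t ^ (((addCell d (a, b) h.2).colLen x.2 : ℤ) - (x.1 : ℤ))) /
      (1 - q ^ (((addCell d (a, b) h.2).rowLen x.1 : ℤ) - (x.2 : ℤ)) *
        t ^ (((addCell d (a, b) h.2).colLen x.2 : ℤ) - (x.1 : ℤ) - 1)) := by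
    unfold bcoef
    rw [show (addCell d (a, b) h.2).cells = insert (a, b) d.cells from rfl,
      Finset.prod_insert hn]
    congr 1
    simp [hR, hC, hr, hc]
  have hq : (1 : K) - q ≠ 0 := by simpa using nz_aux 1 0 (by norm_num) (by norm_num) (by norm_num)
  have e2 : (∏ x ∈ d.cells,
      (1 - q ^ (((addCell d (a, b) h.2).rowLen x.1 : ℤ) - (x.2 : ℤ) - 1) *
        t ^ (((addCell d (a, b) h.2).colLen x.2 : ℤ) - (x.1 : ℤ))) /
      (1 - q ^ (((addCell d (a, b) h.2).rowLen x.1 : ℤ) - (x.2 : ℤ)) *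
        t ^ (((addCell d (a, b) h.2).colLen x.2 : ℤ) - (x.1 : ℤ) - 1))) *
      psiStar (addCell d (a, b) h.2) (a, b) = bcoef d * psi d (a, b) := by
    unfold psiStar psi bcoef
    dsimp only
    rw [prod_row_aux d a b hr, prod_col_aux d b a hc, ← Finset.prod_mul_distrib, ← Finset.prod_mul_distrib]
    apply Finset.prod_congr rfl
    rintro ⟨x, y⟩ hx
    have hx1 : y < d.rowLen x := YoungDiagram.mem_iff_lt_rowLen.1 hx
    have hx2 : x < d.colLen y := YoungDiagram.mem_iff_lt_colLen.1 hx
    dsimp only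
    rw [hR, hC]
    by_cases hxa : x = a
    · subst hxa
      have hyb : y ≠ b := by omega
      simp only [hyb, if_true, if_false, hr]
      push_cast
      rw [show (b : ℤ) + 1 - y - 1 = b - y by ring, show (b : ℤ) + 1 - y = b - y + 1 by ring,
        add_zero]
      have n1 := nz_aux ((b : ℤ) - y) ((d.colLen y : ℤ) - x) (by omega) (by omega) (by omega)
      have n2 := nz_aux ((b : ℤ) - y + 1) ((d.colLen y : ℤ) - x - 1) (by omega) (by omega) (by omega)
      exact alg_row _ _ _ _ n1 n2
    · by_cases hyb : y = b
      · subst hyb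
        simp only [hxa, if_true, if_false, hc]
        push_cast
        rw [show (a : ℤ) + 1 - x - 1 = a - x by ring, show (a : ℤ) + 1 - x = a - x + 1 by ring,
          add_zero]
        have n1 := nz_aux ((d.rowLen x : ℤ) - y) ((a : ℤ) - x - 1) (by omega) (by omega) (by omega)
        have n2 := nz_aux ((d.rowLen x : ℤ) - y - 1) ((a : ℤ) - x) (by omega) (by omega) (by omega)
        exact alg_col _ _ _ _ n1 n2
      · simp [hxa, hyb]
  rw [e1]
  generalize (∏ x ∈ d.cells, _ : K) = P at e2 ⊢
  have e3 : (1 - t) / (1 - q) * (1 - q) = 1 - t := div_mul_cancel₀ _ hq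
  linear_combination (1 - t) * e2 + P * psiStar (addCell d (a, b) h.2) (a, b) * e3

end
end
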